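/- arXiv:1703.10294 — 2 statements merged into one kernel-verified Lean document; each statement's English description precedes it below -/
import Mathlib

section
/- Let H be a Hopf algebra over a field k and J ∈ H ⊗ H a twist, i.e., an invertible element satisfying (ε ⊗ id)(J) = (id ⊗ ε)(J) = 1 and (Δ ⊗ id)(J)(J ⊗ 1) = (id ⊗ Δ)(J)(1 ⊗ J). Then H^J, defined as H as an algebra with comultiplication Δ^J(h) = J⁻¹ Δ(h) J, counit ε, and antipode S^J(h) = v⁻¹ S(h) v where v = m(S ⊗ id)(J), is again a Hopf algebra. -/
open scoped TensorProduct

open scoped TensorProduct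

section QuasiTriangular

variable (k : Type*) [Field k] (H : Type*) [Ring H] [HopfAlgebra k H]

/-- `ε ⊗ id : H ⊗ H → H` (after the canonical identification `k ⊗ H ≅ H`). -/
noncomputable def epsId : H ⊗[k] H →ₗ[k] H :=
  (TensorProduct.lid k H).toLinearMap ∘ₗ
    TensorProduct.map (Coalgebra.counit : H →ₗ[k] k) LinearMap.id

/-- `id ⊗ ε : H ⊗ H → H` (after the canonical identification `H ⊗ k ≅ H`). -/
noncomputable def idEps : H ⊗[k] H →ₗ[k] H :=
  (TensorProduct.rid k H).toLinearMap ∘ₗ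
    TensorProduct.map LinearMap.id (Coalgebra.counit : H →ₗ[k] k)

/-- the embedding of `H ⊗ H` into the first and third tensor factors of
`H ⊗ H ⊗ H`: `a ⊗ b ↦ a ⊗ 1 ⊗ b`. -/
noncomputable def leg13 : H ⊗[k] H →ₗ[k] (H ⊗[k] H) ⊗[k] H :=
  TensorProduct.map ((TensorProduct.mk k H H).flip 1) LinearMap.id

/-- the embedding of `H ⊗ H` into the last two tensor factors of
`H ⊗ H ⊗ H`: `a ⊗ b ↦ 1 ⊗ a ⊗ b`. -/
noncomputable def leg23 : H ⊗[k] H →ₗ[k] (H ⊗[k] H) ⊗[k] H :=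
  TensorProduct.map (TensorProduct.mk k H H 1) LinearMap.id

/-- the embedding of `H ⊗ H` into the first two tensor factors of
`H ⊗ H ⊗ H`: `x ↦ x ⊗ 1`. -/
noncomputable def leg12 : H ⊗[k] H →ₗ[k] (H ⊗[k] H) ⊗[k] H :=
  (TensorProduct.mk k (H ⊗[k] H) H).flip 1

/-- `Δ ⊗ id : H ⊗ H → H ⊗ H ⊗ H` for a comultiplication `Δ`. -/
noncomputable def deltaRight (D : H →ₗ[k] H ⊗[k] H) :
    H ⊗[k] H →ₗ[k] (H ⊗[k] H) ⊗[k] H :=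
  TensorProduct.map D LinearMap.id

/-- `id ⊗ Δ : H ⊗ H → H ⊗ H ⊗ H` for a comultiplication `Δ`. -/
noncomputable def deltaLeft (D : H →ₗ[k] H ⊗[k] H) :
    H ⊗[k] H →ₗ[k] (H ⊗[k] H) ⊗[k] H :=
  (TensorProduct.assoc k H H H).symm.toLinearMap ∘ₗ TensorProduct.map LinearMap.id D

variable {k H} in
/-- `R ∈ H ⊗ H` is an R-matrix for `H` endowed with the comultiplication `D`
(and the counit of `H`): `R` is invertible and satisfies (QT1)–(QT4).
(QT4) `Δ^cop(h) = R Δ(h) R⁻¹` is stated in the equivalent form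
`Δ^cop(h) * R = R * Δ(h)`. -/
noncomputable def IsRMatrixFor (D : H →ₗ[k] H ⊗[k] H) (R : H ⊗[k] H) : Prop :=
  IsUnit R ∧
  deltaRight k H D R = leg13 k H R * leg23 k H R ∧
  deltaLeft k H D R = leg13 k H R * leg12 k H R ∧
  epsId k H R = 1 ∧ idEps k H R = 1 ∧
  ∀ h : H, (TensorProduct.comm k H H) (D h) * R = R * D h

variable {k H} in
/-- The comultiplication `h ↦ A⁻¹ · D(h) · A` obtained by conjugating the
comultiplication `D` by an (invertible) element `A ∈ H ⊗ H`; for a twist `J`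
this is the twisted comultiplication `Δ^J`. -/
noncomputable def conjComul (D : H →ₗ[k] H ⊗[k] H) (A : H ⊗[k] H) :
    H →ₗ[k] H ⊗[k] H :=
  LinearMap.mulLeft k (Ring.inverse A) ∘ₗ LinearMap.mulRight k A ∘ₗ D

variable {k H} in
/-- `J ∈ H ⊗ H` is a twist for `H` endowed with the comultiplication `D`:
`J` is invertible, `(ε ⊗ id)(J) = (id ⊗ ε)(J) = 1` and
`(Δ ⊗ id)(J)(J ⊗ 1) = (id ⊗ Δ)(J)(1 ⊗ J)`. -/
noncomputable def IsTwistFor (D : H →ₗ[k] H ⊗[k] H) (J : H ⊗[k] H) : Prop :=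
  IsUnit J ∧ epsId k H J = 1 ∧ idEps k H J = 1 ∧
  deltaRight k H D J * leg12 k H J = deltaLeft k H D J * leg23 k H J

end QuasiTriangular


namespace TwistAux

open HopfAlgebra Coalgebra TensorProduct

variable {k : Type*} [Field k] {H : Type*} [Ring H] [HopfAlgebra k H]

/-- `m (S ⊗ id)`. -/
noncomputable def phi : H ⊗[k] H →ₗ[k] H :=
  LinearMap.mul' k H ∘ₗ TensorProduct.map (antipode k) LinearMap.id

/-- `m (id ⊗ S)`. -/
noncomputable def psi : H ⊗[k] H →ₗ[k] H :=
  LinearMap.mul' k H ∘ₗ TensorProduct.map LinearMap.id (antipode k)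

@[simp] lemma phi_tmul (a b : H) : phi (a ⊗ₜ[k] b) = antipode k a * b := by simp [phi]
@[simp] lemma psi_tmul (a b : H) : psi (a ⊗ₜ[k] b) = a * antipode k b := by simp [psi]

lemma phi_comul (a : H) : phi (comul (R := k) a) = algebraMap k H (counit a) :=
  mul_antipode_rTensor_comul_apply a

lemma psi_comul (a : H) : psi (comul (R := k) a) = algebraMap k H (counit a) :=
  mul_antipode_lTensor_comul_apply a

/-- `m (id ⊗ S ⊗ id)`. -/
noncomputable def phi3 : (H ⊗[k] H) ⊗[k] H →ₗ[k] H :=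
  LinearMap.mul' k H ∘ₗ TensorProduct.map psi LinearMap.id

/-- `m (S ⊗ id ⊗ S)`. -/
noncomputable def psi3 : (H ⊗[k] H) ⊗[k] H →ₗ[k] H :=
  LinearMap.mul' k H ∘ₗ TensorProduct.map phi (antipode k)

@[simp] lemma phi3_tmul (a b c : H) :
    phi3 ((a ⊗ₜ[k] b) ⊗ₜ[k] c) = a * antipode k b * c := by simp [phi3]
@[simp] lemma psi3_tmul (a b c : H) :
    psi3 ((a ⊗ₜ[k] b) ⊗ₜ[k] c) = antipode k a * b * antipode k c := by simp [psi3]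

@[simp] lemma leg12_tmul (a b : H) : leg12 k H (a ⊗ₜ b) = (a ⊗ₜ b) ⊗ₜ 1 := by simp [leg12]
@[simp] lemma leg23_tmul (a b : H) : leg23 k H (a ⊗ₜ b) = (1 ⊗ₜ a) ⊗ₜ b := by simp [leg23]
@[simp] lemma epsId_tmul (a b : H) : epsId k H (a ⊗ₜ b) = counit (R := k) a • b := by
  simp [epsId]
@[simp] lemma idEps_tmul (a b : H) : idEps k H (a ⊗ₜ b) = counit (R := k) b • a := by
  simp [idEps]
@[simp] lemma deltaRight_tmul (D : H →ₗ[k] H ⊗[k] H) (a b : H) :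
    deltaRight k H D (a ⊗ₜ b) = D a ⊗ₜ b := by simp [deltaRight]
@[simp] lemma deltaLeft_tmul (D : H →ₗ[k] H ⊗[k] H) (a b : H) :
    deltaLeft k H D (a ⊗ₜ b) = (TensorProduct.assoc k H H H).symm (a ⊗ₜ D b) := by
  simp [deltaLeft]

lemma mul_of_tmul {B : Type*} [Ring B] [Algebra k B] {A C : Type*} [Ring A] [Ring C]
    [Algebra k A] [Algebra k C] (f : A ⊗[k] C →ₗ[k] B)
    (h : ∀ a b c d, f ((a * c) ⊗ₜ (b * d)) = f (a ⊗ₜ b) * f (c ⊗ₜ d)) (X Y : A ⊗[k] C) :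
    f (X * Y) = f X * f Y := by
  induction X using TensorProduct.induction_on with
  | zero => simp
  | add x y hx hy => simp [add_mul, hx, hy]
  | tmul a b =>
    induction Y using TensorProduct.induction_on with
    | zero => simp
    | add x y hx hy => simp [mul_add, hx, hy]
    | tmul c d => simp [h]

lemma assocSymm_mul (X Y : H ⊗[k] (H ⊗[k] H)) : (TensorProduct.assoc k H H H).symm (X * Y) =
    (TensorProduct.assoc k H H H).symm X * (TensorProduct.assoc k H H H).symm Y :=
  map_mul (Algebra.TensorProduct.assoc k k k H H H).symm X Y

lemma leg12_mul (X Y : H ⊗[k] H) : leg12 k H (X * Y) = leg12 k H X * leg12 k H Y :=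
  mul_of_tmul _ (by simp) X Y
lemma leg23_mul (X Y : H ⊗[k] H) : leg23 k H (X * Y) = leg23 k H X * leg23 k H Y :=
  mul_of_tmul _ (by simp) X Y
lemma epsId_mul (X Y : H ⊗[k] H) : epsId k H (X * Y) = epsId k H X * epsId k H Y :=
  mul_of_tmul _ (by simp [smul_smul, mul_comm]) X Y
lemma idEps_mul (X Y : H ⊗[k] H) : idEps k H (X * Y) = idEps k H X * idEps k H Y :=
  mul_of_tmul _ (by simp [smul_smul, mul_comm]) X Y
lemma deltaRight_mul (X Y : H ⊗[k] H) :
    deltaRight k H comul (X * Y) = deltaRight k H comul X * deltaRight k H comul Y :=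
  mul_of_tmul _ (by simp) X Y
lemma deltaLeft_mul (X Y : H ⊗[k] H) :
    deltaLeft k H comul (X * Y) = deltaLeft k H comul X * deltaLeft k H comul Y :=
  mul_of_tmul _ (by intros; simp [← assocSymm_mul]) X Y

lemma leg12_one : leg12 k H 1 = 1 := by
  rw [Algebra.TensorProduct.one_def, leg12_tmul]; rfl
lemma leg23_one : leg23 k H 1 = 1 := by
  rw [Algebra.TensorProduct.one_def, leg23_tmul]; rfl
lemma epsId_one : epsId k H 1 = 1 := by
  rw [Algebra.TensorProduct.one_def, epsId_tmul]; simp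
lemma idEps_one : idEps k H 1 = 1 := by
  rw [Algebra.TensorProduct.one_def, idEps_tmul]; simp
lemma deltaRight_one : deltaRight k H comul 1 = 1 := by
  rw [Algebra.TensorProduct.one_def, deltaRight_tmul, Bialgebra.comul_one]; rfl
lemma deltaLeft_one : deltaLeft k H comul 1 = 1 := by
  rw [Algebra.TensorProduct.one_def, deltaLeft_tmul, Bialgebra.comul_one]; rfl

/-- Bilinear induction principle on two tensors. -/
lemma bilin_ext {M N P Q B : Type*} [AddCommGroup M] [AddCommGroup N] [AddCommGroup P]
    [AddCommGroup Q] [AddCommGroup B] [Module k M] [Module k N] [Module k P] [Module k Q]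
    [Module k B] (f g : M ⊗[k] N → P ⊗[k] Q → B)
    (hf0 : ∀ Y, f 0 Y = g 0 Y) (hf0' : ∀ X, f X 0 = g X 0)
    (hf1 : ∀ X X' Y, f (X + X') Y = f X Y + f X' Y)
    (hg1 : ∀ X X' Y, g (X + X') Y = g X Y + g X' Y)
    (hf2 : ∀ X Y Y', f X (Y + Y') = f X Y + f X Y')
    (hg2 : ∀ X Y Y', g X (Y + Y') = g X Y + g X Y')
    (h : ∀ a b c d, f (a ⊗ₜ b) (c ⊗ₜ d) = g (a ⊗ₜ b) (c ⊗ₜ d))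
    (X : M ⊗[k] N) (Y : P ⊗[k] Q) : f X Y = g X Y := by
  induction X using TensorProduct.induction_on with
  | zero => exact hf0 Y
  | add x y hx hy => rw [hf1, hg1, hx, hy]
  | tmul a b =>
    induction Y using TensorProduct.induction_on with
    | zero => exact hf0' _
    | add x y hx hy => rw [hf2, hg2, hx, hy]
    | tmul c d => exact h a b c d

lemma phi3_legs (X Y : H ⊗[k] H) : phi3 (leg23 k H X * leg12 k H Y) = psi Y * phi X := by
  refine bilin_ext (fun X Y => phi3 (leg23 k H X * leg12 k H Y)) (fun X Y => psi Y * phi X)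
    ?_ ?_ ?_ ?_ ?_ ?_ ?_ X Y <;> intros <;>
  simp [mul_add, add_mul, antipode_mul_antidistrib, mul_assoc]

lemma psi3_legs (X Y : H ⊗[k] H) : psi3 (leg12 k H X * leg23 k H Y) = phi X * psi Y := by
  refine bilin_ext (fun X Y => psi3 (leg12 k H X * leg23 k H Y)) (fun X Y => phi X * psi Y)
    ?_ ?_ ?_ ?_ ?_ ?_ ?_ X Y <;> intros <;>
  simp [mul_add, add_mul, antipode_mul_antidistrib, mul_assoc]

lemma phi3_aux (c b : H) (X Y : H ⊗[k] H) :
    phi3 ((TensorProduct.assoc k H H H).symm (c ⊗ₜ X) * (Y ⊗ₜ b)) =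
      c * (psi Y * (phi X * b)) := by
  refine bilin_ext
    (fun X Y => phi3 ((TensorProduct.assoc k H H H).symm (c ⊗ₜ X) * (Y ⊗ₜ b)))
    (fun X Y => c * (psi Y * (phi X * b)))
    ?_ ?_ ?_ ?_ ?_ ?_ ?_ X Y <;> intros <;>
  simp [mul_add, add_mul, antipode_mul_antidistrib, mul_assoc, tmul_add, add_tmul]

lemma psi3_aux (a d : H) (X Y : H ⊗[k] H) :
    psi3 ((X ⊗ₜ d) * (TensorProduct.assoc k H H H).symm (a ⊗ₜ Y)) =
      antipode k a * (phi X * (psi Y * antipode k d)) := by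
  refine bilin_ext
    (fun X Y => psi3 ((X ⊗ₜ d) * (TensorProduct.assoc k H H H).symm (a ⊗ₜ Y)))
    (fun X Y => antipode k a * (phi X * (psi Y * antipode k d)))
    ?_ ?_ ?_ ?_ ?_ ?_ ?_ X Y <;> intros <;>
  simp [mul_add, add_mul, antipode_mul_antidistrib, mul_assoc, tmul_add, add_tmul]

lemma phi3_delta (X Y : H ⊗[k] H) :
    phi3 (deltaLeft k H comul X * deltaRight k H comul Y) = idEps k H X * epsId k H Y := by
  refine bilin_ext (fun X Y => phi3 (deltaLeft k H comul X * deltaRight k H comul Y))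
    (fun X Y => idEps k H X * epsId k H Y)
    ?_ ?_ ?_ ?_ ?_ ?_ ?_ X Y <;> intros <;>
  simp [mul_add, add_mul, phi3_aux, psi_comul, phi_comul, Algebra.algebraMap_eq_smul_one,
    smul_smul, mul_comm]

lemma psi3_delta (X Y : H ⊗[k] H) :
    psi3 (deltaRight k H comul X * deltaLeft k H comul Y) =
      antipode k (idEps k H Y) * antipode k (epsId k H X) := by
  refine bilin_ext (fun X Y => psi3 (deltaRight k H comul X * deltaLeft k H comul Y))
    (fun X Y => antipode k (idEps k H Y) * antipode k (epsId k H X))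
    ?_ ?_ ?_ ?_ ?_ ?_ ?_ X Y <;> intros <;>
  simp [mul_add, add_mul, psi3_aux, psi_comul, phi_comul, Algebra.algebraMap_eq_smul_one,
    smul_smul, mul_comm]

lemma phi_comul_mul (x : H) (Y : H ⊗[k] H) :
    phi (comul (R := k) x * Y) = counit (R := k) x • phi Y := by
  induction Y using TensorProduct.induction_on with
  | zero => simp
  | add x y hx hy => simp [mul_add, hx, hy]
  | tmul a b =>
    have (X : H ⊗[k] H) : phi (X * (a ⊗ₜ b)) = antipode k a * phi X * b := by
      induction X using TensorProduct.induction_on with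
      | zero => simp
      | add x y hx hy => simp [mul_add, add_mul, hx, hy]
      | tmul c d => simp [antipode_mul_antidistrib, mul_assoc]
    simp [this, phi_comul, Algebra.algebraMap_eq_smul_one]

lemma psi_mul_comul (x : H) (Y : H ⊗[k] H) :
    psi (Y * comul (R := k) x) = counit (R := k) x • psi Y := by
  induction Y using TensorProduct.induction_on with
  | zero => simp
  | add x y hx hy => simp [add_mul, hx, hy]
  | tmul a b =>
    have (X : H ⊗[k] H) : psi ((a ⊗ₜ b) * X) = a * psi X * antipode k b := by
      induction X using TensorProduct.induction_on with
      | zero => simp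
      | add x y hx hy => simp [mul_add, add_mul, hx, hy]
      | tmul c d => simp [antipode_mul_antidistrib, mul_assoc]
    simp [this, psi_comul, Algebra.algebraMap_eq_smul_one]

lemma twisted_left (u : H) (X J : H ⊗[k] H) :
    LinearMap.mul' k H (TensorProduct.map (LinearMap.mulLeft k u ∘ₗ
      LinearMap.mulRight k (phi J) ∘ₗ antipode k) LinearMap.id X) = u * phi (J * X) := by
  refine bilin_ext (fun X J => LinearMap.mul' k H (TensorProduct.map (LinearMap.mulLeft k u ∘ₗ
      LinearMap.mulRight k (phi J) ∘ₗ antipode k) LinearMap.id X))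
    (fun X J => u * phi (J * X)) ?_ ?_ ?_ ?_ ?_ ?_ ?_ X J
  · simp
  · intro X
    induction X using TensorProduct.induction_on with
    | zero => simp
    | add x y hx hy => simp_all
    | tmul c d => simp
  · simp
  · simp [mul_add]
  · intro X J J'
    induction X using TensorProduct.induction_on with
    | zero => simp
    | add x y hx hy => simp only [map_add] at *; rw [hx, hy]; abel
    | tmul c d => simp [mul_add, add_mul]
  · simp [mul_add, add_mul]
  · simp [antipode_mul_antidistrib, mul_assoc]

lemma twisted_right (v : H) (X K : H ⊗[k] H) :
    LinearMap.mul' k H (TensorProduct.map LinearMap.id (LinearMap.mulLeft k (psi K) ∘ₗ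
      LinearMap.mulRight k v ∘ₗ antipode k) X) = psi (X * K) * v := by
  refine bilin_ext (fun X K => LinearMap.mul' k H (TensorProduct.map LinearMap.id
      (LinearMap.mulLeft k (psi K) ∘ₗ LinearMap.mulRight k v ∘ₗ antipode k) X))
    (fun X K => psi (X * K) * v) ?_ ?_ ?_ ?_ ?_ ?_ ?_ X K
  · simp
  · intro X
    induction X using TensorProduct.induction_on with
    | zero => simp
    | add x y hx hy => simp_all
    | tmul c d => simp
  · simp
  · simp [add_mul]
  · intro X J J'
    induction X using TensorProduct.induction_on with
    | zero => simp
    | add x y hx hy => simp only [map_add] at *; rw [hx, hy]; abel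
    | tmul c d => simp [mul_add, add_mul]
  · simp [mul_add, add_mul]
  · simp [antipode_mul_antidistrib, mul_assoc]

lemma deltaRight_conj (J X : H ⊗[k] H) :
    deltaRight k H (conjComul comul J) X =
      leg12 k H (Ring.inverse J) * deltaRight k H comul X * leg12 k H J := by
  induction X using TensorProduct.induction_on with
  | zero => simp
  | add x y hx hy => simp [mul_add, add_mul, hx, hy]
  | tmul c d => simp [conjComul, leg12, mul_assoc]

lemma leg23_eq (X : H ⊗[k] H) :
    leg23 k H X = (TensorProduct.assoc k H H H).symm (1 ⊗ₜ X) := by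
  induction X using TensorProduct.induction_on with
  | zero => simp
  | add x y hx hy => simp [tmul_add, hx, hy]
  | tmul c d => simp

lemma deltaLeft_conj (J X : H ⊗[k] H) :
    deltaLeft k H (conjComul comul J) X =
      leg23 k H (Ring.inverse J) * deltaLeft k H comul X * leg23 k H J := by
  induction X using TensorProduct.induction_on with
  | zero => simp
  | add x y hx hy => simp [mul_add, add_mul, hx, hy]
  | tmul c d => simp [conjComul, leg23_eq, ← assocSymm_mul, mul_assoc]

end TwistAux

/-- Let `H` be a Hopf algebra over a field `k` and `J ∈ H ⊗ H`
a twist.  Then `H^J` — `H` as an algebra, with comultiplication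
`Δ^J(h) = J⁻¹ Δ(h) J`, counit `ε`, and antipode `S^J(h) = v⁻¹ S(h) v` where
`v = m((S ⊗ id)(J))` — is again a Hopf algebra: `v` is invertible, `Δ^J` is
coassociative and counital, and `S^J` satisfies the antipode axioms. -/
theorem twisted_hopfAlgebra (k : Type*) [Field k] (H : Type*) [Ring H]
    [HopfAlgebra k H] (J : H ⊗[k] H)
    (hJ : IsTwistFor (Coalgebra.comul : H →ₗ[k] H ⊗[k] H) J) :
    let D' := conjComul (Coalgebra.comul : H →ₗ[k] H ⊗[k] H) J
    let S := HopfAlgebra.antipode (R := k) (A := H)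
    let v := LinearMap.mul' k H (TensorProduct.map S LinearMap.id J)
    let S' := LinearMap.mulLeft k (Ring.inverse v) ∘ₗ LinearMap.mulRight k v ∘ₗ S
    IsUnit v ∧
    (∀ x : H, (TensorProduct.assoc k H H H)
        (TensorProduct.map D' LinearMap.id (D' x)) =
      TensorProduct.map LinearMap.id D' (D' x)) ∧
    (∀ x : H, epsId k H (D' x) = x) ∧
    (∀ x : H, idEps k H (D' x) = x) ∧
    (∀ x : H, LinearMap.mul' k H (TensorProduct.map S' LinearMap.id (D' x)) =
      algebraMap k H (Coalgebra.counit x)) ∧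
    (∀ x : H, LinearMap.mul' k H (TensorProduct.map LinearMap.id S' (D' x)) =
      algebraMap k H (Coalgebra.counit x)) := by
  intro D' S v S'
  obtain ⟨hu, he1, he2, hc⟩ := hJ
  have hJK : J * Ring.inverse J = 1 := Ring.mul_inverse_cancel J hu
  have hKJ : Ring.inverse J * J = 1 := Ring.inverse_mul_cancel J hu
  have hD' : ∀ x, D' x = Ring.inverse J * (Coalgebra.comul x * J) := fun x => rfl
  have hdr : ∀ X, deltaRight k H D' X = _ := fun X => TwistAux.deltaRight_conj J X
  have hdl : ∀ X, deltaLeft k H D' X = _ := fun X => TwistAux.deltaLeft_conj J X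
  generalize hK : Ring.inverse J = K at *
  have e1K : epsId k H K = 1 := by
    have := congrArg (epsId k H) hJK
    rwa [TwistAux.epsId_mul, he1, one_mul, TwistAux.epsId_one] at this
  have e2K : idEps k H K = 1 := by
    have := congrArg (idEps k H) hJK
    rwa [TwistAux.idEps_mul, he2, one_mul, TwistAux.idEps_one] at this
  have r1 := congrArg (deltaRight k H Coalgebra.comul) hJK
  have r2 := congrArg (deltaRight k H Coalgebra.comul) hKJ
  have l1 := congrArg (deltaLeft k H Coalgebra.comul) hJK
  have l2 := congrArg (deltaLeft k H Coalgebra.comul) hKJ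
  have a1 := congrArg (leg12 k H) hJK
  have a2 := congrArg (leg12 k H) hKJ
  have b1 := congrArg (leg23 k H) hJK
  have b2 := congrArg (leg23 k H) hKJ
  rw [TwistAux.deltaRight_mul, TwistAux.deltaRight_one] at r1 r2
  rw [TwistAux.deltaLeft_mul, TwistAux.deltaLeft_one] at l1 l2
  rw [TwistAux.leg12_mul, TwistAux.leg12_one] at a1 a2
  rw [TwistAux.leg23_mul, TwistAux.leg23_one] at b1 b2
  have hwv : TwistAux.psi K * TwistAux.phi J = 1 := by
    rw [← TwistAux.phi3_legs]
    have : leg23 k H J * leg12 k H K =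
        deltaLeft k H Coalgebra.comul K * deltaRight k H Coalgebra.comul J := by
      calc _ = (deltaLeft k H Coalgebra.comul K * deltaLeft k H Coalgebra.comul J) *
            leg23 k H J * leg12 k H K := by rw [l2, one_mul]
        _ = deltaLeft k H Coalgebra.comul K * (deltaLeft k H Coalgebra.comul J *
            leg23 k H J) * leg12 k H K := by simp only [mul_assoc]
        _ = deltaLeft k H Coalgebra.comul K * deltaRight k H Coalgebra.comul J *
            (leg12 k H J * leg12 k H K) := by rw [← hc]; simp only [mul_assoc]
        _ = _ := by rw [a1, mul_one]
    rw [this, TwistAux.phi3_delta, e2K, he1, one_mul]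
  have hvw : TwistAux.phi J * TwistAux.psi K = 1 := by
    rw [← TwistAux.psi3_legs]
    have : leg12 k H J * leg23 k H K =
        deltaRight k H Coalgebra.comul K * deltaLeft k H Coalgebra.comul J := by
      calc _ = (deltaRight k H Coalgebra.comul K * deltaRight k H Coalgebra.comul J) *
            leg12 k H J * leg23 k H K := by rw [r2, one_mul]
        _ = deltaRight k H Coalgebra.comul K * (deltaRight k H Coalgebra.comul J *
            leg12 k H J) * leg23 k H K := by simp only [mul_assoc]
        _ = deltaRight k H Coalgebra.comul K * deltaLeft k H Coalgebra.comul J *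
            (leg23 k H J * leg23 k H K) := by rw [hc]; simp only [mul_assoc]
        _ = _ := by rw [b1, mul_one]
    rw [this, TwistAux.psi3_delta, e1K, he2, HopfAlgebra.antipode_one, one_mul]
  have hv : v = TwistAux.phi J := rfl
  have hvu : IsUnit v := ⟨⟨TwistAux.phi J, TwistAux.psi K, hvw, hwv⟩, rfl⟩
  have hinv : Ring.inverse v = TwistAux.psi K := by
    have := Ring.inverse_mul_cancel v hvu
    calc _ = Ring.inverse v * (v * TwistAux.psi K) := by rw [hv, hvw, mul_one]
      _ = _ := by rw [← mul_assoc, this, one_mul]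
  have hS' : S' = LinearMap.mulLeft k (TwistAux.psi K) ∘ₗ
      LinearMap.mulRight k (TwistAux.phi J) ∘ₗ HopfAlgebra.antipode k := by
    rw [← hinv]; rfl
  have hcx : ∀ x : H, deltaRight k H Coalgebra.comul (Coalgebra.comul (R := k) x) =
      deltaLeft k H Coalgebra.comul (Coalgebra.comul (R := k) x) := fun x =>
    (Coalgebra.coassoc_symm_apply x).symm
  refine ⟨hvu, ?_, ?_, ?_, ?_, ?_⟩
  · intro x
    apply (TensorProduct.assoc k H H H).symm.injective
    rw [LinearEquiv.symm_apply_apply]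
    change deltaRight k H D' (D' x) = deltaLeft k H D' (D' x)
    rw [hdr, hdl, hD']
    simp only [TwistAux.deltaRight_mul, TwistAux.deltaLeft_mul, mul_assoc]
    rw [hc, hcx]
    have key : leg12 k H K * deltaRight k H Coalgebra.comul K =
        leg23 k H K * deltaLeft k H Coalgebra.comul K := by
      refine left_inv_eq_right_inv
        (a := deltaRight k H Coalgebra.comul J * leg12 k H J) ?_ ?_
      · rw [mul_assoc, ← mul_assoc _ _ (leg12 k H J), r2, one_mul, a2]
      · rw [hc, mul_assoc, ← mul_assoc _ _ (deltaLeft k H Coalgebra.comul K), b1, one_mul, l1]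
    simp only [← mul_assoc]
    rw [key]
  · intro x
    rw [hD', TwistAux.epsId_mul, TwistAux.epsId_mul, e1K, he1, one_mul, mul_one]
    have := Coalgebra.rTensor_counit_comul (R := k) x
    change TensorProduct.lid k H ((Coalgebra.counit (R := k) (A := H)).rTensor H
      (Coalgebra.comul x)) = x
    rw [this]; simp
  · intro x
    rw [hD', TwistAux.idEps_mul, TwistAux.idEps_mul, e2K, he2, one_mul, mul_one]
    have := Coalgebra.lTensor_counit_comul (R := k) x
    change TensorProduct.rid k H ((Coalgebra.counit (R := k) (A := H)).lTensor H
      (Coalgebra.comul x)) = x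
    rw [this]; simp
  · intro x
    rw [hS', TwistAux.twisted_left, hD', ← mul_assoc J, hJK, one_mul, TwistAux.phi_comul_mul,
      mul_smul_comm, hwv, Algebra.algebraMap_eq_smul_one]
  · intro x
    rw [hS', TwistAux.twisted_right, hD', mul_assoc, mul_assoc, hJK, mul_one,
      TwistAux.psi_mul_comul, smul_mul_assoc, hwv, Algebra.algebraMap_eq_smul_one]
end

section
/- Let k → K →^i H →^π L → k be an exact sequence of finite-dimensional Hopf algebras (i injective Hopf map, π surjective Hopf map, π ∘ i = ε_K·1, ker π = H·i(K)⁺). Then dim H = dim K · dim L. -/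
open scoped TensorProduct

namespace HopfDim

open Coalgebra TensorProduct

section reps

variable {k A V W U V' W' : Type*} [Field k] [Ring A] [Bialgebra k A]
  [AddCommGroup V] [Module k V] [AddCommGroup W] [Module k W] [AddCommGroup U] [Module k U]
  [AddCommGroup V'] [Module k V'] [AddCommGroup W'] [Module k W']

/-- external tensor product of two representations. -/
noncomputable def ext2 (ρ : A →ₐ[k] Module.End k V) (σ : A →ₐ[k] Module.End k W) :
    A ⊗[k] A →ₐ[k] Module.End k (V ⊗[k] W) :=
  (Module.endTensorEndAlgHom (R := k) (S := k) (A := k) (M := V) (N := W)).comp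
    (Algebra.TensorProduct.map ρ σ)

lemma ext2_tmul (ρ : A →ₐ[k] Module.End k V) (σ : A →ₐ[k] Module.End k W) (a b : A) :
    ext2 ρ σ (a ⊗ₜ b) = TensorProduct.map (ρ a) (σ b) := by
  rfl

/-- tensor product of representations of a bialgebra. -/
noncomputable def tens (ρ : A →ₐ[k] Module.End k V) (σ : A →ₐ[k] Module.End k W) :
    A →ₐ[k] Module.End k (V ⊗[k] W) :=
  (ext2 ρ σ).comp (Bialgebra.comulAlgHom k A)

lemma tens_apply (ρ : A →ₐ[k] Module.End k V) (σ : A →ₐ[k] Module.End k W) (x : A) :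
    tens ρ σ x = ext2 ρ σ (comul x) := rfl

/-- multiple of a representation. -/
noncomputable def amp (ρ : A →ₐ[k] Module.End k V) (W : Type*) [AddCommGroup W] [Module k W] :
    A →ₐ[k] Module.End k (V ⊗[k] W) :=
  ((Module.endTensorEndAlgHom (R := k) (S := k) (A := k) (M := V) (N := W)).comp
    Algebra.TensorProduct.includeLeft).comp ρ

lemma amp_apply (ρ : A →ₐ[k] Module.End k V) (x : A) :
    amp ρ W x = (ρ x).rTensor W := rfl

/-- equivariance. -/
def Equi (ρ : A →ₐ[k] Module.End k V) (σ : A →ₐ[k] Module.End k W) (f : V →ₗ[k] W) : Prop :=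
  ∀ x v, f (ρ x v) = σ x (f v)

lemma Equi.map {ρ : A →ₐ[k] Module.End k V} {σ : A →ₐ[k] Module.End k W}
    {ρ' : A →ₐ[k] Module.End k V'} {σ' : A →ₐ[k] Module.End k W'}
    {f : V →ₗ[k] V'} {g : W →ₗ[k] W'} (hf : Equi ρ ρ' f) (hg : Equi σ σ' g) :
    Equi (tens ρ σ) (tens ρ' σ') (TensorProduct.map f g) := by
  intro x u
  rw [tens_apply, tens_apply]
  generalize (comul x : A ⊗[k] A) = z
  induction z with
  | zero => simp
  | add a b ha hb => simp [ha, hb]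
  | tmul a b =>
    rw [ext2_tmul, ext2_tmul]
    induction u with
    | zero => simp
    | add a b ha hb => simp only [map_add, ha, hb]
    | tmul v w => simp [hf a v, hg b w]

lemma Equi.id (ρ : A →ₐ[k] Module.End k V) : Equi ρ ρ LinearMap.id := fun _ _ => rfl

lemma equi_assoc (ρ : A →ₐ[k] Module.End k V) (σ : A →ₐ[k] Module.End k W)
    (τ : A →ₐ[k] Module.End k U) :
    Equi (tens (tens ρ σ) τ) (tens ρ (tens σ τ)) (TensorProduct.assoc k V W U).toLinearMap := by
  intro x t
  induction t with
  | zero => simp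
  | add a b ha hb => simp only [map_add, ha, hb]
  | tmul t u =>
  induction t with
  | zero => simp
  | add a b ha hb => simp only [map_add, add_tmul, ha, hb]
  | tmul v w =>
  let N : A ⊗[k] (A ⊗[k] A) →ₗ[k] V ⊗[k] (W ⊗[k] U) :=
    TensorProduct.map (ρ.toLinearMap.flip v)
      (TensorProduct.map (σ.toLinearMap.flip w) (τ.toLinearMap.flip u))
  have h1 : ∀ z : A ⊗[k] A,
      (TensorProduct.assoc k V W U) (ext2 (tens ρ σ) τ z ((v ⊗ₜ w) ⊗ₜ u)) =
      N (TensorProduct.assoc k A A A (comul.rTensor A z)) := by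
    intro z
    induction z with
    | zero => simp
    | add a b ha hb => simp only [map_add, LinearMap.add_apply, ha, hb]
    | tmul p q =>
      rw [ext2_tmul, LinearMap.rTensor_tmul, TensorProduct.map_tmul, tens_apply]
      generalize (comul p : A ⊗[k] A) = y
      induction y with
      | zero => simp
      | add a b ha hb => simp only [map_add, LinearMap.add_apply, add_tmul, ha, hb]
      | tmul p p' => simp [ext2_tmul, N]
  have h2 : ∀ z : A ⊗[k] A,
      (ext2 ρ (tens σ τ) z (v ⊗ₜ (w ⊗ₜ u))) = N (comul.lTensor A z) := by
    intro z
    induction z with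
    | zero => simp
    | add a b ha hb => simp only [map_add, LinearMap.add_apply, ha, hb]
    | tmul p q =>
      rw [ext2_tmul, LinearMap.lTensor_tmul, TensorProduct.map_tmul, tens_apply]
      generalize (comul q : A ⊗[k] A) = y
      induction y with
      | zero => simp
      | add a b ha hb => simp only [map_add, LinearMap.add_apply, tmul_add, ha, hb]
      | tmul p p' => simp [ext2_tmul, N]
  have h3 := h1 (comul x)
  have h4 := h2 (comul x)
  rw [Coalgebra.coassoc_apply] at h3
  rw [tens_apply, tens_apply]
  exact h3.trans h4.symm

lemma equi_assoc_amp (ρ : A →ₐ[k] Module.End k V) (σ : A →ₐ[k] Module.End k W) :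
    Equi (amp (tens ρ σ) U) (tens ρ (amp σ U)) (TensorProduct.assoc k V W U).toLinearMap := by
  intro x t
  induction t with
  | zero => simp
  | add a b ha hb => simp only [map_add, ha, hb]
  | tmul t u =>
  induction t with
  | zero => simp
  | add a b ha hb => simp only [map_add, add_tmul, ha, hb]
  | tmul v w =>
  rw [amp_apply, LinearMap.rTensor_tmul, tens_apply, tens_apply]
  generalize (comul x : A ⊗[k] A) = y
  induction y with
  | zero => simp
  | add a b ha hb => simp only [map_add, LinearMap.add_apply, add_tmul, ha, hb]
  | tmul p p' => simp [ext2_tmul, amp_apply]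

/-- invariant functionals. -/
def inv (ρ : A →ₐ[k] Module.End k V) : Submodule k (V →ₗ[k] k) where
  carrier := {φ | ∀ x v, φ (ρ x v) = counit (R := k) x * φ v}
  add_mem' := by
    intro a b ha hb x v
    simp [ha x v, hb x v, mul_add]
  zero_mem' := by intro x v; simp
  smul_mem' := by
    intro c a ha x v
    simp [ha x v]; ring

lemma mem_inv (ρ : A →ₐ[k] Module.End k V) (φ : V →ₗ[k] k) :
    φ ∈ inv ρ ↔ ∀ x v, φ (ρ x v) = counit (R := k) x * φ v := Iff.rfl

instance inv_free (ρ : A →ₐ[k] Module.End k V) : Module.Free k (inv ρ) :=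
  Module.Free.of_divisionRing k (inv ρ)

/-- dimension of the space of invariant functionals. -/
noncomputable def G (ρ : A →ₐ[k] Module.End k V) : ℕ := Module.finrank k (inv ρ)

/-- pull back of invariant functionals. -/
def pull {ρ : A →ₐ[k] Module.End k V} {σ : A →ₐ[k] Module.End k W} (f : V →ₗ[k] W)
    (hf : Equi ρ σ f) : inv σ →ₗ[k] inv ρ :=
  (f.dualMap.comp (inv σ).subtype).codRestrict (inv ρ) (by
    intro φ x v
    simp [hf x v, φ.2 x (f v)])

lemma pull_apply {ρ : A →ₐ[k] Module.End k V} {σ : A →ₐ[k] Module.End k W} (f : V →ₗ[k] W)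
    (hf : Equi ρ σ f) (φ : inv σ) (v : V) : (pull f hf φ).1 v = φ.1 (f v) := rfl

lemma Equi.symm {ρ : A →ₐ[k] Module.End k V} {σ : A →ₐ[k] Module.End k W} {e : V ≃ₗ[k] W}
    (he : Equi ρ σ e.toLinearMap) : Equi σ ρ e.symm.toLinearMap := by
  intro x w
  apply e.injective
  have := he x (e.symm w)
  simp at this
  simp [this]

lemma G_congr {ρ : A →ₐ[k] Module.End k V} {σ : A →ₐ[k] Module.End k W} (e : V ≃ₗ[k] W)
    (he : Equi ρ σ e.toLinearMap) : G ρ = G σ := by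
  refine LinearEquiv.finrank_eq (LinearEquiv.ofLinearMap (pull _ he.symm) (pull _ he) ?_ ?_)
  · ext φ v; simp [pull_apply]
  · ext φ v; simp [pull_apply]

lemma G_split [FiniteDimensional k V] [FiniteDimensional k W]
    {ρ : A →ₐ[k] Module.End k V} {σ : A →ₐ[k] Module.End k W}
    {τ : A →ₐ[k] Module.End k U} (j : V →ₗ[k] U) (p : U →ₗ[k] V) (j' : W →ₗ[k] U)
    (p' : U →ₗ[k] W) (hj : Equi ρ τ j) (hp : Equi τ ρ p) (hj' : Equi σ τ j') (hp' : Equi τ σ p')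
    (h1 : p ∘ₗ j = LinearMap.id) (h2 : p' ∘ₗ j' = LinearMap.id) (h3 : p ∘ₗ j' = 0)
    (h4 : p' ∘ₗ j = 0) (h5 : j ∘ₗ p + j' ∘ₗ p' = LinearMap.id) :
    G τ = G ρ + G σ := by
  unfold G
  rw [← Module.finrank_prod]
  have h1 := fun v => LinearMap.congr_fun h1 v
  have h2 := fun v => LinearMap.congr_fun h2 v
  have h3 := fun v => LinearMap.congr_fun h3 v
  have h4 := fun v => LinearMap.congr_fun h4 v
  have h5 := fun v => LinearMap.congr_fun h5 v
  simp at h1 h2 h3 h4 h5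
  refine LinearEquiv.finrank_eq (LinearEquiv.ofLinearMap ((pull j hj).prod (pull j' hj'))
    ((pull p hp).coprod (pull p' hp')) ?_ ?_)
  · refine LinearMap.ext fun φ => Prod.ext (Subtype.ext (LinearMap.ext fun v => ?_))
      (Subtype.ext (LinearMap.ext fun v => ?_))
    · simp [pull_apply, h1, h4]
    · simp [pull_apply, h2, h3]
  · refine LinearMap.ext fun φ => (Subtype.ext (LinearMap.ext fun v => ?_))
    simp only [LinearMap.comp_apply, LinearMap.prod_apply, Function.prod, LinearMap.coprod_apply,
      Submodule.coe_add, LinearMap.add_apply, pull_apply, LinearMap.id_apply]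
    rw [← map_add, h5]

lemma G_le [FiniteDimensional k V] (ρ : A →ₐ[k] Module.End k V) : G ρ ≤ Module.finrank k V := by
  unfold G
  rw [← Subspace.dual_finrank_eq (K := k) (V := V)]
  exact Submodule.finrank_le _

lemma G_amp [FiniteDimensional k V] [FiniteDimensional k W] (ρ : A →ₐ[k] Module.End k V) :
    G (amp ρ W) = Module.finrank k W * G ρ := by
  unfold G
  rw [← Module.finrank_linearMap k k W (inv ρ)]
  let F : inv (amp ρ W) →ₗ[k] (W →ₗ[k] inv ρ) :=
    { toFun := fun φ => LinearMap.codRestrict (inv ρ) ((TensorProduct.mk k V W).flip.compr₂ φ.1)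
        (by
          intro w x v
          simpa [amp_apply] using φ.2 x (v ⊗ₜ w))
      map_add' := by intro a b; rfl
      map_smul' := by intro a b; rfl }
  let B : (W →ₗ[k] inv ρ) →ₗ[k] inv (amp ρ W) :=
    { toFun := fun f => ⟨TensorProduct.lift ((inv ρ).subtype.comp f).flip, by
        intro x t
        induction t with
        | zero => simp
        | add a b ha hb => simp only [map_add, mul_add, ha, hb]
        | tmul v w => simpa [amp_apply] using (f w).2 x v⟩
      map_add' := by intro a b; ext; simp
      map_smul' := by intro a b; ext; simp }
  refine LinearEquiv.finrank_eq (LinearEquiv.ofLinearMap F B ?_ ?_)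
  · refine LinearMap.ext fun f => LinearMap.ext fun w => Subtype.ext (LinearMap.ext fun v => ?_)
    change TensorProduct.lift ((inv ρ).subtype.comp f).flip (v ⊗ₜ w) = (f w).1 v
    simp
  · refine LinearMap.ext fun φ => Subtype.ext (TensorProduct.ext' fun v w => ?_)
    change TensorProduct.lift ((inv ρ).subtype.comp (F φ)).flip (v ⊗ₜ w) = φ.1 (v ⊗ₜ w)
    rw [TensorProduct.lift.tmul]
    rfl

lemma G_reg : G (Algebra.lmul k A) = 1 := by
  unfold G
  have hε : (counit : A →ₗ[k] k) ∈ inv (Algebra.lmul k A) := by intro x v; simp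
  refine finrank_eq_one (⟨counit, hε⟩ : inv (Algebra.lmul k A)) ?_ ?_
  · intro h
    have := congrArg (fun f => f.1 (1 : A)) h
    simp at this
  · intro φ
    refine ⟨φ.1 1, Subtype.ext (LinearMap.ext fun v => ?_)⟩
    have := φ.2 v 1
    simp at this
    simp [this, mul_comm]

end reps
end HopfDim

namespace HopfDim

open Coalgebra TensorProduct HopfAlgebra

section hopf

variable {k A V : Type*} [Field k] [Ring A] [HopfAlgebra k A]
  [AddCommGroup V] [Module k V]

/-- The map `a ⊗ v ↦ a₁ ⊗ f(a₂) v`. -/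
noncomputable def Mop (f : A →ₗ[k] Module.End k V) : A ⊗[k] V →ₗ[k] A ⊗[k] V :=
  (TensorProduct.lift f).lTensor A ∘ₗ (TensorProduct.assoc k A A V).toLinearMap ∘ₗ
    comul.rTensor V

lemma Mop_tmul (f : A →ₗ[k] Module.End k V) (a : A) (v : V) :
    Mop f (a ⊗ₜ v) = (f.flip v).lTensor A (comul a) := by
  simp only [Mop, LinearMap.comp_apply, LinearMap.rTensor_tmul]
  generalize (comul a : A ⊗[k] A) = z
  induction z with
  | zero => simp
  | add a b ha hb => simp only [map_add, add_tmul, ha, hb]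
  | tmul p q => simp

lemma Mop_Mop (ρ : A →ₐ[k] Module.End k V) (t : A ⊗[k] V) :
    Mop (ρ.toLinearMap ∘ₗ antipode k) (Mop ρ.toLinearMap t) = t := by
  induction t with
  | zero => simp
  | add a b ha hb => simp only [map_add, ha, hb]
  | tmul a v =>
  let n : A ⊗[k] A →ₗ[k] V :=
    (ρ.toLinearMap.flip v) ∘ₗ LinearMap.mul' k A ∘ₗ (antipode k).rTensor A
  have h1 : ∀ z : A ⊗[k] A, Mop (ρ.toLinearMap ∘ₗ antipode k)
      ((ρ.toLinearMap.flip v).lTensor A z) =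
      n.lTensor A (TensorProduct.assoc k A A A (comul.rTensor A z)) := by
    intro z
    induction z with
    | zero => simp
    | add a b ha hb => simp only [map_add, ha, hb]
    | tmul p q =>
      rw [LinearMap.lTensor_tmul, Mop_tmul, LinearMap.rTensor_tmul]
      generalize (comul p : A ⊗[k] A) = y
      induction y with
      | zero => simp
      | add a b ha hb => simp only [map_add, add_tmul, ha, hb]
      | tmul p p' => simp [n]
  rw [Mop_tmul, h1, Coalgebra.coassoc_apply, ← LinearMap.lTensor_comp_apply]
  have h2 : n ∘ₗ comul = (LinearMap.toSpanSingleton k V v) ∘ₗ counit := by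
    ext b
    simp [n, Algebra.algebraMap_eq_smul_one]
  rw [h2, LinearMap.lTensor_comp_apply, Coalgebra.lTensor_counit_comul]
  simp

lemma Mop_equi (ρ : A →ₐ[k] Module.End k V) :
    Equi (amp (Algebra.lmul k A) V) (tens (Algebra.lmul k A) ρ) (Mop ρ.toLinearMap) := by
  intro x t
  induction t with
  | zero => simp
  | add a b ha hb => simp only [map_add, ha, hb]
  | tmul a v =>
  rw [amp_apply, LinearMap.rTensor_tmul, Mop_tmul, Mop_tmul, tens_apply]
  have : (comul (Algebra.lmul k A x a) : A ⊗[k] A) = comul x * comul a := by simp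
  rw [this]
  generalize (comul x : A ⊗[k] A) = z
  generalize (comul a : A ⊗[k] A) = y
  induction z with
  | zero => simp
  | add a b ha hb => simp only [map_add, add_mul, LinearMap.add_apply, ha, hb]
  | tmul p q =>
  induction y with
  | zero => simp
  | add a b ha hb => simp only [map_add, mul_add, ha, hb]
  | tmul p' q' => simp [ext2_tmul]

/-- `Mop` as an equivalence. -/
noncomputable def MopE [FiniteDimensional k A] [FiniteDimensional k V]
    (ρ : A →ₐ[k] Module.End k V) : A ⊗[k] V ≃ₗ[k] A ⊗[k] V :=
  LinearEquiv.ofInjectiveEndo (Mop ρ.toLinearMap)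
    (Function.LeftInverse.injective (Mop_Mop ρ))

lemma MopE_equi [FiniteDimensional k A] [FiniteDimensional k V] (ρ : A →ₐ[k] Module.End k V) :
    Equi (amp (Algebra.lmul k A) V) (tens (Algebra.lmul k A) ρ) (MopE ρ).toLinearMap :=
  Mop_equi ρ

/-- contragredient of the regular representation -/
noncomputable def contra : A →ₐ[k] Module.End k (Module.Dual k A) :=
  AlgHom.ofLinearMap
    ({ toFun := fun x => (LinearMap.mulLeft k (antipode k x)).dualMap
       map_add' := by intro a b; ext; simp [add_mul]
       map_smul' := by intro a b; ext; simp } : A →ₗ[k] Module.End k (Module.Dual k A))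
    (by ext; simp)
    (by intro a b; ext; simp [antipode_mul_antidistrib])

lemma contra_apply (x : A) (φ : Module.Dual k A) (y : A) :
    contra x φ y = φ (antipode k x * y) := rfl

lemma exists_integral [FiniteDimensional k A] [Nontrivial A] :
    ∃ Λ : A, Λ ≠ 0 ∧ ∀ x : A, x * Λ = counit (R := k) x • Λ := by
  let D : A ⊗[k] Module.Dual k A ≃ₗ[k] (A →ₗ[k] A) :=
    (TensorProduct.comm k A (Module.Dual k A)).trans (dualTensorHomEquiv k A A)
  have hD : ∀ (a : A) (φ : Module.Dual k A) (y : A), D (a ⊗ₜ φ) y = φ y • a := by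
    intro a φ y; simp [D]
  have hD2 : ∀ (p q : A) (t : A ⊗[k] Module.Dual k A),
      D (TensorProduct.map (Algebra.lmul k A p) (contra q) t) =
      LinearMap.mulLeft k p ∘ₗ D t ∘ₗ LinearMap.mulLeft k (antipode k q) := by
    intro p q t
    induction t with
    | zero => simp
    | add a b ha hb => simp only [map_add, ha, hb, LinearMap.comp_add, LinearMap.add_comp]
    | tmul a φ => ext y; simp [hD, contra_apply]
  let ι := D.symm LinearMap.id
  have hι : ∀ x : A, tens (Algebra.lmul k A) contra x ι = counit (R := k) x • ι := by
    intro x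
    apply D.injective
    have h1 : ∀ z : A ⊗[k] A, D (ext2 (Algebra.lmul k A) contra z ι) =
        LinearMap.mulLeft k (LinearMap.mul' k A ((antipode k).lTensor A z)) := by
      intro z
      induction z with
      | zero => ext; simp
      | add a b ha hb => ext; simp [ha, hb, add_mul]
      | tmul p q => rw [ext2_tmul, hD2]; ext; simp [ι]
    rw [tens_apply, h1]
    ext y
    simp [ι, Algebra.smul_def]
  let w := (MopE (contra (k := k) (A := A))).symm ι
  have hw0 : w ≠ 0 := by
    intro h
    have h2 : ι = 0 := by simpa [w] using h
    have h3 : D ι = 0 := by rw [h2]; simp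
    have h4 := LinearMap.congr_fun h3 (1 : A)
    simp [ι] at h4
  have hw : ∀ x : A, (LinearMap.mulLeft k x).rTensor (Module.Dual k A) w = counit (R := k) x • w := by
    intro x
    have := (MopE_equi (contra (k := k) (A := A))).symm x ι
    rw [hι] at this
    simp only [LinearEquiv.coe_coe, map_smul] at this
    exact this.symm
  have hDw : D w ≠ 0 := by simpa using hw0
  obtain ⟨z, hz⟩ : ∃ z, D w z ≠ 0 := by
    by_contra! h
    exact hDw (LinearMap.ext h)
  refine ⟨D w z, hz, fun x => ?_⟩
  have h5 : ∀ t : A ⊗[k] Module.Dual k A,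
      D ((LinearMap.mulLeft k x).rTensor (Module.Dual k A) t) z = x * D t z := by
    intro t
    induction t with
    | zero => simp
    | add a b ha hb => simp only [map_add, LinearMap.add_apply, mul_add, ha, hb]
    | tmul a φ => simp [hD]
  rw [← h5, hw]
  simp

lemma integral_shift (Λ : A) (hΛ : ∀ x : A, x * Λ = counit (R := k) x • Λ) (x : A) :
    (1 ⊗ₜ x : A ⊗[k] A) * comul Λ = (antipode k x ⊗ₜ 1) * comul Λ := by
  let Φ : A ⊗[k] (A ⊗[k] A) →ₗ[k] A ⊗[k] A :=
    (LinearMap.mul' k A ∘ₗ (antipode k).rTensor A).rTensor A ∘ₗ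
      (TensorProduct.assoc k A A A).symm.toLinearMap
  have h0 : Φ (comul.lTensor A (comul x)) = 1 ⊗ₜ x := by
    simp only [Φ, LinearMap.comp_apply, LinearEquiv.coe_coe]
    rw [Coalgebra.coassoc_symm_apply, ← LinearMap.rTensor_comp_apply]
    have : (LinearMap.mul' k A ∘ₗ (antipode k).rTensor A) ∘ₗ comul =
        (Algebra.linearMap k A) ∘ₗ counit := by
      rw [LinearMap.comp_assoc]; exact mul_antipode_rTensor_comul
    rw [this, LinearMap.rTensor_comp_apply, Coalgebra.rTensor_counit_comul]
    simp
  have h1 : ∀ z : A ⊗[k] A, Φ (comul.lTensor A z) * comul Λ =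
      ((TensorProduct.rid k A (counit.lTensor A ((antipode k).rTensor A z))) ⊗ₜ 1) * comul Λ := by
    intro z
    induction z with
    | zero => simp
    | add a b ha hb => simp only [map_add, add_mul, add_tmul, ha, hb]
    | tmul p q =>
      have h2 : ∀ y : A ⊗[k] A, Φ (p ⊗ₜ y) = (antipode k p ⊗ₜ 1) * y := by
        intro y
        induction y with
        | zero => simp
        | add a b ha hb => simp only [map_add, mul_add, tmul_add, ha, hb]
        | tmul a b => simp [Φ]
      rw [LinearMap.lTensor_tmul, h2, mul_assoc, ← Bialgebra.comul_mul, hΛ]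
      simp [← smul_tmul']
  rw [← h0, h1, ← LinearMap.comp_apply, LinearMap.lTensor_comp_rTensor,
    ← LinearMap.rTensor_comp_lTensor, LinearMap.comp_apply, Coalgebra.lTensor_counit_comul]
  simp

lemma exists_frobenius [FiniteDimensional k A] [Nontrivial A] :
    ∃ l : A →ₗ[k] k, ∃ Λ : A, ∀ x : A,
      TensorProduct.lid k A
        ((l ∘ₗ LinearMap.mulLeft k (antipode k x)).rTensor A (comul Λ)) = x := by
  obtain ⟨Λ, hΛ0, hΛ⟩ := exists_integral (k := k) (A := A)
  have hs := integral_shift Λ hΛ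
  obtain ⟨φ, hφ⟩ : ∃ φ : A →ₗ[k] k, φ Λ = 1 := 
    Module.Projective.exists_dual_eq_one k hΛ0
  -- the shifted contraction
  have key : ∀ (f : A →ₗ[k] k) (x : A),
      TensorProduct.lid k A ((f ∘ₗ LinearMap.mulLeft k (antipode k x)).rTensor A (comul Λ)) =
      x * TensorProduct.lid k A (f.rTensor A (comul Λ)) := by
    intro f x
    have h1 : ∀ z : A ⊗[k] A, TensorProduct.lid k A (f.rTensor A ((1 ⊗ₜ x) * z)) =
        x * TensorProduct.lid k A (f.rTensor A z) := by
      intro z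
      induction z with
      | zero => simp
      | add a b ha hb => simp only [map_add, mul_add, ha, hb]
      | tmul a b => simp
    have h2 : ∀ z : A ⊗[k] A,
        (f ∘ₗ LinearMap.mulLeft k (antipode k x)).rTensor A z =
        f.rTensor A ((antipode k x ⊗ₜ 1) * z) := by
      intro z
      induction z with
      | zero => simp
      | add a b ha hb => simp only [map_add, mul_add, ha, hb]
      | tmul a b => simp
    rw [h2, ← hs, h1]
  let θ : A →ₗ[k] A := (TensorProduct.lid k A).toLinearMap ∘ₗ
    TensorProduct.map φ (antipode k) ∘ₗ comul
  have hθ : LinearMap.mul' k A (θ.rTensor A (comul Λ)) = 1 := by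
    let n : A ⊗[k] (A ⊗[k] A) →ₗ[k] A :=
      (TensorProduct.lid k A).toLinearMap ∘ₗ
        TensorProduct.map φ (LinearMap.mul' k A ∘ₗ (antipode k).rTensor A)
    have h1 : ∀ z : A ⊗[k] A, LinearMap.mul' k A (θ.rTensor A z) =
        n (TensorProduct.assoc k A A A (comul.rTensor A z)) := by
      intro z
      induction z with
      | zero => simp
      | add a b ha hb => simp only [map_add, ha, hb]
      | tmul p q =>
        simp only [θ, LinearMap.rTensor_tmul, LinearMap.comp_apply, LinearMap.mul'_apply]
        generalize (comul p : A ⊗[k] A) = y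
        induction y with
        | zero => simp
        | add a b ha hb => simp only [map_add, add_mul, add_tmul, ha, hb]
        | tmul a b => simp [n]
    have h2 : ∀ z : A ⊗[k] A, n (comul.lTensor A z) =
        algebraMap k A (φ (TensorProduct.rid k A (counit.lTensor A z))) := by
      intro z
      induction z with
      | zero => simp
      | add a b ha hb => simp only [map_add, ha, hb]
      | tmul p q => simp [n, Algebra.algebraMap_eq_smul_one, smul_smul, mul_comm]
    rw [h1, Coalgebra.coassoc_apply, h2, Coalgebra.lTensor_counit_comul]
    simp [hφ]
  let b := Module.finBasis k A
  let l : A →ₗ[k] k := ∑ j, (b.coord j ∘ₗ θ) ∘ₗ LinearMap.mulLeft k (antipode k (b j))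
  have hl : TensorProduct.lid k A (l.rTensor A (comul Λ)) = 1 := by
    rw [← hθ]
    have h3 : ∀ z : A ⊗[k] A, ∑ j, b j * TensorProduct.lid k A ((b.coord j ∘ₗ θ).rTensor A z) =
        LinearMap.mul' k A (θ.rTensor A z) := by
      intro z
      induction z with
      | zero => simp
      | add a b ha hb => simp only [map_add, mul_add, Finset.sum_add_distrib, ha, hb]
      | tmul p q =>
        have := congrArg (· * q) (b.sum_repr (θ p))
        simp only [Finset.sum_mul] at this
        simpa using this
    rw [← h3]
    simp_rw [← key]
    simp only [l]
    have h4 : ∀ (f : Fin (Module.finrank k A) → (A →ₗ[k] k)) (z : A ⊗[k] A),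
        (∑ j, f j).rTensor A z = ∑ j, (f j).rTensor A z := by
      intro f z
      have := map_sum (LinearMap.rTensorHom (R := k) (N := A) (P := k) A) f Finset.univ
      have h5 := LinearMap.congr_fun this z
      rw [LinearMap.sum_apply] at h5
      exact h5
    rw [h4, map_sum]
  refine ⟨l, Λ, fun x => ?_⟩
  rw [key, hl, mul_one]

lemma antipode_bijective [FiniteDimensional k A] [Nontrivial A] :
    Function.Bijective (antipode k : A →ₗ[k] A) := by
  obtain ⟨l, Λ, h⟩ := exists_frobenius (k := k) (A := A)
  have hinj : Function.Injective (antipode k : A →ₗ[k] A) := by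
    intro x y hxy
    rw [← h x, hxy, h y]
  exact ⟨hinj, LinearMap.surjective_of_injective hinj⟩

lemma exists_nondeg [FiniteDimensional k A] [Nontrivial A] :
    ∃ l : A →ₗ[k] k, ∀ a : A, (∀ y, l (y * a) = 0) → a = 0 := by
  obtain ⟨l, Λ, h⟩ := exists_frobenius (k := k) (A := A)
  refine ⟨l, ?_⟩
  let B : A →ₗ[k] Module.Dual k A := (LinearMap.mul k A).compr₂ l
  have hB : Function.Injective B := by
    rw [← LinearMap.ker_eq_bot, LinearMap.ker_eq_bot']
    intro a ha
    obtain ⟨x, rfl⟩ := (antipode_bijective (k := k) (A := A)).2 a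
    have h0 : l ∘ₗ LinearMap.mulLeft k (antipode k x) = 0 := by
      ext y
      exact LinearMap.congr_fun ha y
    have := h x
    rw [h0] at this
    simp at this
    simp [← this]
  have hs : Function.Surjective B :=
    (LinearMap.injective_iff_surjective_of_finrank_eq_finrank
      (Subspace.dual_finrank_eq (K := k) (V := A)).symm).1 hB
  intro a ha
  rw [← Module.forall_dual_apply_eq_zero_iff k]
  intro φ
  obtain ⟨y, rfl⟩ := hs φ
  exact ha y

end hopf
end HopfDim

namespace HopfDim

open Coalgebra TensorProduct HopfAlgebra

section hopf2

variable {k A V : Type*} [Field k] [Ring A] [HopfAlgebra k A]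
  [AddCommGroup V] [Module k V]

/-- The map `a ⊗ v ↦ f(a₁) v ⊗ a₂`. -/
noncomputable def Nop (f : A →ₗ[k] Module.End k V) : A ⊗[k] V →ₗ[k] V ⊗[k] A :=
  TensorProduct.lift (LinearMap.mk₂ k (fun a v => (f.flip v).rTensor A (comul a))
    (by intro a b v; simp) (by intro c a v; simp)
    (by intro a v w; simp [LinearMap.rTensor_add]) (by intro c a v; simp [LinearMap.rTensor_smul]))

lemma Nop_tmul (f : A →ₗ[k] Module.End k V) (a : A) (v : V) :
    Nop f (a ⊗ₜ v) = (f.flip v).rTensor A (comul a) := by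
  simp [Nop]

/-- The map `v ⊗ a ↦ f(a₁) v ⊗ a₂`. -/
noncomputable def Nop' (f : A →ₗ[k] Module.End k V) : V ⊗[k] A →ₗ[k] V ⊗[k] A :=
  Nop f ∘ₗ (TensorProduct.comm k V A).toLinearMap

lemma Nop'_tmul (f : A →ₗ[k] Module.End k V) (a : A) (v : V) :
    Nop' f (v ⊗ₜ a) = (f.flip v).rTensor A (comul a) := by
  simp [Nop', Nop_tmul]

lemma sinv_mul (T : A →ₗ[k] A) (hT : ∀ a, antipode k (T a) = a)
    (hinj : Function.Injective (antipode k : A →ₗ[k] A)) (a : A) :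
    LinearMap.mul' k A (T.rTensor A (TensorProduct.comm k A A (comul a))) =
      algebraMap k A (counit a) := by
  apply hinj
  have h : ∀ z : A ⊗[k] A,
      antipode k (LinearMap.mul' k A (T.rTensor A (TensorProduct.comm k A A z))) =
      LinearMap.mul' k A ((antipode k).rTensor A z) := by
    intro z
    induction z with
    | zero => simp
    | add a b ha hb => simp only [map_add, ha, hb]
    | tmul p q => simp [antipode_mul_antidistrib, hT]
  rw [h]
  simp [Algebra.algebraMap_eq_smul_one]

lemma Nop_inj [FiniteDimensional k A] [Nontrivial A] (ρ : A →ₐ[k] Module.End k V) :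
    Function.Injective (Nop ρ.toLinearMap) := by
  have hS := antipode_bijective (k := k) (A := A)
  let T : A →ₗ[k] A := (LinearEquiv.ofBijective (antipode k : A →ₗ[k] A) hS).symm.toLinearMap
  have hT : ∀ a, antipode k (T a) = a := fun a =>
    (LinearEquiv.ofBijective (antipode k : A →ₗ[k] A) hS).apply_symm_apply a
  have key : ∀ t, Nop' (ρ.toLinearMap ∘ₗ T) (Nop ρ.toLinearMap t) =
      TensorProduct.comm k A V t := by
    intro t
    induction t with
    | zero => simp
    | add a b ha hb => simp only [map_add, ha, hb]
    | tmul a v =>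
    let n : A ⊗[k] A →ₗ[k] V := (ρ.toLinearMap.flip v) ∘ₗ LinearMap.mul' k A ∘ₗ T.rTensor A ∘ₗ
      (TensorProduct.comm k A A).toLinearMap
    have h1 : ∀ z : A ⊗[k] A, Nop' (ρ.toLinearMap ∘ₗ T)
        ((ρ.toLinearMap.flip v).rTensor A z) =
        n.rTensor A ((TensorProduct.assoc k A A A).symm (comul.lTensor A z)) := by
      intro z
      induction z with
      | zero => simp
      | add a b ha hb => simp only [map_add, ha, hb]
      | tmul p q =>
        rw [LinearMap.rTensor_tmul, Nop'_tmul, LinearMap.lTensor_tmul]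
        generalize (comul q : A ⊗[k] A) = y
        induction y with
        | zero => simp
        | add a b ha hb => simp only [map_add, tmul_add, ha, hb]
        | tmul p p' => simp [n]
    rw [Nop_tmul, h1, Coalgebra.coassoc_symm_apply, ← LinearMap.rTensor_comp_apply]
    have h2 : n ∘ₗ comul = (LinearMap.toSpanSingleton k V v) ∘ₗ counit := by
      ext b
      have := sinv_mul T hT hS.1 b
      simp only [n, LinearMap.comp_apply, LinearEquiv.coe_coe, this]
      simp [Algebra.algebraMap_eq_smul_one]
    rw [h2, LinearMap.rTensor_comp_apply, Coalgebra.rTensor_counit_comul]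
    simp
  intro s t hst
  apply (TensorProduct.comm k A V).injective
  rw [← key, ← key, hst]

lemma Nop_equi (ρ : A →ₐ[k] Module.End k V) :
    Equi (amp (Algebra.lmul k A) V) (tens ρ (Algebra.lmul k A)) (Nop ρ.toLinearMap) := by
  intro x t
  induction t with
  | zero => simp
  | add a b ha hb => simp only [map_add, ha, hb]
  | tmul a v =>
  rw [amp_apply, LinearMap.rTensor_tmul, Nop_tmul, Nop_tmul, tens_apply]
  have : (comul (Algebra.lmul k A x a) : A ⊗[k] A) = comul x * comul a := by simp
  rw [this]
  generalize (comul x : A ⊗[k] A) = z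
  generalize (comul a : A ⊗[k] A) = y
  induction z with
  | zero => simp
  | add a b ha hb => simp only [map_add, add_mul, LinearMap.add_apply, ha, hb]
  | tmul p q =>
  induction y with
  | zero => simp
  | add a b ha hb => simp only [map_add, mul_add, ha, hb]
  | tmul p' q' => simp [ext2_tmul]

lemma G_tens_reg [FiniteDimensional k A] [Nontrivial A] [FiniteDimensional k V]
    (ρ : A →ₐ[k] Module.End k V) : G (tens ρ (Algebra.lmul k A)) = Module.finrank k V := by
  have hfr : Module.finrank k (A ⊗[k] V) = Module.finrank k (V ⊗[k] A) :=
    (TensorProduct.comm k A V).finrank_eq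
  let e := LinearEquiv.ofBijective (Nop ρ.toLinearMap) ⟨Nop_inj ρ,
    (LinearMap.injective_iff_surjective_of_finrank_eq_finrank hfr).1 (Nop_inj ρ)⟩
  rw [← G_congr e (Nop_equi ρ), G_amp, G_reg, mul_one]

end hopf2

section pair

universe u v

variable {k K : Type*} {H : Type u} [Field k] [Ring K] [Ring H] [HopfAlgebra k K] [HopfAlgebra k H]
  [FiniteDimensional k K] [FiniteDimensional k H] (i : K →ₐc[k] H)

lemma tens_comp {V W : Type*} [AddCommGroup V] [Module k V] [AddCommGroup W] [Module k W]
    (ρ : H →ₐ[k] Module.End k V) (σ : H →ₐ[k] Module.End k W) (x : K) :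
    tens (ρ.comp (i : K →ₐ[k] H)) (σ.comp (i : K →ₐ[k] H)) x = tens ρ σ (i x) := by
  rw [tens_apply, tens_apply, ← CoalgHomClass.map_comp_comul_apply]
  generalize (comul x : K ⊗[k] K) = z
  induction z with
  | zero => simp
  | add a b ha hb => simp only [map_add, ha, hb]
  | tmul a b => rfl

/-- `H` as a representation of `K`. -/
noncomputable def hrep : K →ₐ[k] Module.End k H := (Algebra.lmul k H).comp (i : K →ₐ[k] H)

lemma hrep_apply (x : K) (h : H) : hrep i x h = i x * h := rfl

lemma MopH_equi : Equi (amp (hrep i) H) (tens (hrep i) (hrep i))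
    (MopE (Algebra.lmul k H)).toLinearMap := by
  intro x t
  have := MopE_equi (Algebra.lmul k H) (i x) t
  unfold hrep
  rw [tens_comp]
  exact this

lemma G_tens_tens {V X : Type*} [AddCommGroup V] [Module k V] [AddCommGroup X] [Module k X]
    [FiniteDimensional k V] [FiniteDimensional k X]
    (ρ : K →ₐ[k] Module.End k V) (χ : K →ₐ[k] Module.End k X) (e : X ⊗[k] H ≃ₗ[k] X ⊗[k] H)
    (he : Equi (amp χ H) (tens χ (hrep i)) e.toLinearMap) :
    G (tens (tens ρ χ) (hrep i)) = Module.finrank k H * G (tens ρ χ) := by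
  rw [← G_amp (W := H) (tens ρ χ), G_congr _ (equi_assoc ρ χ (hrep i)),
    G_congr _ (equi_assoc_amp ρ χ (U := H))]
  symm
  exact G_congr (TensorProduct.congr (LinearEquiv.refl k V) e) ((Equi.id ρ).map he)

lemma exists_retraction [Nontrivial K] (hi : Function.Injective i) :
    ∃ r : H →ₗ[k] K, (∀ x h, r (i x * h) = x * r h) ∧ ∀ x, r (i x) = x := by
  obtain ⟨l, hl⟩ := exists_nondeg (k := k) (A := K)
  let i' : K →ₗ[k] H := (i : K →ₐ[k] H).toLinearMap
  have hi' : ∀ x, i' x = i x := fun _ => rfl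
  obtain ⟨s, hs⟩ := LinearMap.exists_leftInverse_of_injective i' (LinearMap.ker_eq_bot.2 hi)
  have hs' : ∀ x, s (i x) = x := fun x => LinearMap.congr_fun hs x
  let m : K →ₗ[k] Module.Dual k K := ((LinearMap.mul k K).compr₂ l).flip
  have hm : ∀ a y, m a y = l (y * a) := fun _ _ => rfl
  have hinj : Function.Injective m := by
    rw [← LinearMap.ker_eq_bot, LinearMap.ker_eq_bot']
    intro a ha
    exact hl a (fun y => by rw [← hm, ha]; rfl)
  have hsur : Function.Surjective m :=
    (LinearMap.injective_iff_surjective_of_finrank_eq_finrank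
      (Subspace.dual_finrank_eq (K := k) (V := K)).symm).1 hinj
  let e := LinearEquiv.ofBijective m ⟨hinj, hsur⟩
  let c : H →ₗ[k] Module.Dual k K := (((LinearMap.mul k H).comp i').compr₂ (l ∘ₗ s)).flip
  have hc : ∀ h y, c h y = l (s (i y * h)) := fun _ _ => rfl
  have her : ∀ h y, l (y * e.symm (c h)) = l (s (i y * h)) := by
    intro h y
    rw [← hm, ← hc]
    exact LinearMap.congr_fun (e.apply_symm_apply (c h)) y
  refine ⟨e.symm.toLinearMap ∘ₗ c, fun x h => ?_, fun x => ?_⟩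
  · apply hinj
    ext y
    rw [hm, hm]
    simp only [LinearMap.comp_apply, LinearEquiv.coe_coe]
    rw [her, ← mul_assoc y x, her, map_mul i, mul_assoc]
  · apply hinj
    ext y
    rw [hm, hm]
    simp only [LinearMap.comp_apply, LinearEquiv.coe_coe]
    rw [her, ← map_mul, hs']

/-- representation on the kernel of the retraction -/
noncomputable def qrep (r : H →ₗ[k] K) (hr : ∀ x h, r (i x * h) = x * r h) :
    K →ₐ[k] Module.End k (LinearMap.ker r) :=
  AlgHom.ofLinearMap
    ({ toFun := fun x => (hrep i x).restrict (p := LinearMap.ker r) (q := LinearMap.ker r) (by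
          intro h hh
          rw [LinearMap.mem_ker] at hh ⊢
          rw [hrep_apply, hr, hh, mul_zero])
       map_add' := by intro a b; ext; simp
       map_smul' := by intro a b; ext; simp } : K →ₗ[k] Module.End k (LinearMap.ker r))
    (by ext; simp)
    (by intro a b; ext; simp)

lemma qrep_apply (r : H →ₗ[k] K) (hr : ∀ x h, r (i x * h) = x * r h) (x : K)
    (q : LinearMap.ker r) : (qrep i r hr x q : H) = i x * q := rfl

lemma recurrence [Nontrivial K] (r : H →ₗ[k] K) (hr : ∀ x h, r (i x * h) = x * r h)
    (hri : ∀ x, r (i x) = x) {V : Type*} [AddCommGroup V] [Module k V] [FiniteDimensional k V]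
    (ρ : K →ₐ[k] Module.End k V) :
    Module.finrank k H * G (tens ρ (hrep i)) = Module.finrank k H * Module.finrank k V +
      G (tens (tens ρ (qrep i r hr)) (hrep i)) := by
  rw [← G_tens_tens i ρ (hrep i) _ (MopH_equi i), ← G_tens_reg ρ,
    ← G_tens_tens i ρ (Algebra.lmul k K) _ (MopE_equi (hrep i))]
  let i' : K →ₗ[k] H := (i : K →ₐ[k] H).toLinearMap
  have hi' : ∀ x, i' x = i x := fun _ => rfl
  let j' := (LinearMap.ker r).subtype
  let p' : H →ₗ[k] LinearMap.ker r := (LinearMap.id - i' ∘ₗ r).codRestrict (LinearMap.ker r) (by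
    intro h; simp [hi', hri])
  have hp' : ∀ h, (p' h : H) = h - i (r h) := fun _ => rfl
  have e1 : Equi (Algebra.lmul k K) (hrep i) i' := by
    intro x y; simp [hi', hrep_apply]
  have e2 : Equi (hrep i) (Algebra.lmul k K) r := by
    intro x y; simp [hr, hrep_apply]
  have e3 : Equi (qrep i r hr) (hrep i) j' := by
    intro x y; rfl
  have e4 : Equi (hrep i) (qrep i r hr) p' := by
    intro x y
    apply Subtype.ext
    rw [hp', qrep_apply, hp', hrep_apply, hr, map_mul, mul_sub]
  have c1 : r ∘ₗ i' = LinearMap.id := by ext x; simp [hi', hri]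
  have c2 : p' ∘ₗ j' = LinearMap.id := by
    ext x
    have : r x = 0 := x.2
    simp [hp', j', this]
  have c3 : r ∘ₗ j' = 0 := by ext x; exact x.2
  have c4 : p' ∘ₗ i' = 0 := by ext x; simp [hp', hi', hri]
  have c5 : i' ∘ₗ r + j' ∘ₗ p' = LinearMap.id := by ext x; simp [j', hp', hi']
  refine G_split _ _ _ _ (((Equi.id ρ).map e1).map (Equi.id (hrep i)))
    (((Equi.id ρ).map e2).map (Equi.id (hrep i))) (((Equi.id ρ).map e3).map (Equi.id (hrep i)))
    (((Equi.id ρ).map e4).map (Equi.id (hrep i))) ?_ ?_ ?_ ?_ ?_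
  · simp only [← TensorProduct.map_comp, c1, LinearMap.comp_id, TensorProduct.map_id]
  · simp only [← TensorProduct.map_comp, c2, LinearMap.comp_id, TensorProduct.map_id]
  · simp only [← TensorProduct.map_comp, c3, LinearMap.comp_id, TensorProduct.map_zero_left,
      TensorProduct.map_zero_right]
  · simp only [← TensorProduct.map_comp, c4, LinearMap.comp_id, TensorProduct.map_zero_left,
      TensorProduct.map_zero_right]
  · simp only [← TensorProduct.map_comp, ← TensorProduct.map_add_left,
      ← TensorProduct.map_add_right, c5, LinearMap.comp_id, TensorProduct.map_id]

lemma bound [Nontrivial K] (r : H →ₗ[k] K) (hr : ∀ x h, r (i x * h) = x * r h)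
    (hri : ∀ x, r (i x) = x) (q : ℕ) (hq : Module.finrank k H = Module.finrank k K + q)
    (hq' : Module.finrank k (LinearMap.ker r) = q) (n : ℕ) :
    ∀ (V : Type u) [AddCommGroup V] [Module k V] [FiniteDimensional k V]
    (ρ : K →ₐ[k] Module.End k V),
    |(Module.finrank k K : ℤ) * G (tens ρ (hrep i)) - Module.finrank k H * Module.finrank k V| *
      (Module.finrank k H : ℤ) ^ n ≤
    (Module.finrank k K : ℤ) * Module.finrank k H * Module.finrank k V * (q : ℤ) ^ n +
    Module.finrank k H * Module.finrank k V * (q : ℤ) ^ n := by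
  induction n with
  | zero =>
    intro V _ _ _ ρ
    have h1 := G_le (tens ρ (hrep i))
    rw [Module.finrank_tensorProduct] at h1
    have h2 : (G (tens ρ (hrep i)) : ℤ) ≤ Module.finrank k V * Module.finrank k H := by
      exact_mod_cast h1
    simp only [pow_zero, mul_one]
    have h3 : (0 : ℤ) ≤ G (tens ρ (hrep i)) := by positivity
    have h4 : (0 : ℤ) ≤ Module.finrank k K := by positivity
    have h5 : (0 : ℤ) ≤ Module.finrank k H * Module.finrank k V := by positivity
    rw [abs_le]
    constructor <;> nlinarith
  | succ n ih =>
    intro V _ _ _ ρ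
    have h1 := ih (V ⊗[k] LinearMap.ker r) (tens ρ (qrep i r hr))
    have h2 := recurrence i r hr hri ρ
    rw [Module.finrank_tensorProduct, hq'] at h1
    generalize G (tens ρ (hrep i)) = a at *
    generalize G (tens (tens ρ (qrep i r hr)) (hrep i)) = b at *
    have h3 : (Module.finrank k H : ℤ) * a = Module.finrank k H * Module.finrank k V + b := by
      exact_mod_cast h2
    have hq2 : (Module.finrank k H : ℤ) = Module.finrank k K + q := by exact_mod_cast hq
    have h4 : (Module.finrank k K : ℤ) * b - Module.finrank k H * (Module.finrank k V * q : ℕ) =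
      (Module.finrank k K * a - Module.finrank k H * Module.finrank k V) * Module.finrank k H := by
      push_cast
      have : (b : ℤ) = Module.finrank k H * a - Module.finrank k H * Module.finrank k V := by
        linarith
      rw [this]
      have hq3 : (q : ℤ) = Module.finrank k H - Module.finrank k K := by linarith
      rw [hq3]
      ring
    rw [h4, abs_mul, abs_of_nonneg (by positivity : (0 : ℤ) ≤ Module.finrank k H)] at h1
    push_cast at h1
    rw [pow_succ', pow_succ']
    calc _ = _ := by rw [← mul_assoc]
      _ ≤ _ := h1
      _ = _ := by ring

lemma main_dim [Nontrivial K] (hi : Function.Injective i) :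
    Module.finrank k K * G (hrep i) = Module.finrank k H := by
  obtain ⟨r, hr, hri⟩ := exists_retraction i hi
  have hsur : Function.Surjective r := fun x => ⟨i x, hri x⟩
  have hq : Module.finrank k H = Module.finrank k K + Module.finrank k (LinearMap.ker r) := by
    rw [← LinearMap.finrank_range_add_finrank_ker r, LinearMap.range_eq_top.2 hsur, finrank_top]
  have hb := fun n => bound i r hr hri _ hq rfl n H (hrep i)
  have hG : G (tens (hrep i) (hrep i)) = Module.finrank k H * G (hrep i) := by
    rw [← G_congr _ (MopH_equi i), G_amp]
  have hK : 0 < Module.finrank k K := Module.finrank_pos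
  generalize Module.finrank k (LinearMap.ker r) = q at *
  rw [hG] at hb
  generalize Module.finrank k H = h at *
  generalize Module.finrank k K = κ at *
  generalize G (hrep i) = g at *
  by_contra hne
  have hh : (0 : ℝ) < h := by
    have : 0 < h := by omega
    exact_mod_cast this
  have hD : (1 : ℝ) ≤ |(κ : ℝ) * (h * g : ℕ) - h * h| := by
    have : (κ : ℤ) * (h * g : ℕ) - h * h ≠ 0 := by
      intro h0
      apply hne
      have h1 : (h : ℤ) * (κ * g) = h * h := by push_cast at h0; linarith
      have h2 : h * (κ * g) = h * h := by exact_mod_cast h1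
      exact Nat.eq_of_mul_eq_mul_left (by omega) h2
    have := Int.one_le_abs this
    exact_mod_cast this
  have hb' : ∀ n, (1 : ℝ) ≤ (κ * h * h + h * h) * ((q : ℝ) / h) ^ n := by
    intro n
    have h1 : |(κ : ℝ) * (h * g : ℕ) - h * h| * (h : ℝ) ^ n ≤
      (κ : ℝ) * h * h * (q : ℝ) ^ n + h * h * (q : ℝ) ^ n := by exact_mod_cast hb n
    have hp : (0 : ℝ) < (h : ℝ) ^ n := by positivity
    rw [div_pow, ← mul_div_assoc, le_div_iff₀ hp]
    nlinarith
  have hlim : Filter.Tendsto (fun n : ℕ => ((κ : ℝ) * h * h + h * h) * ((q : ℝ) / h) ^ n)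
      Filter.atTop (nhds (((κ : ℝ) * h * h + h * h) * 0)) := by
    refine (tendsto_pow_atTop_nhds_zero_of_lt_one (by positivity) ?_).const_mul _
    rw [div_lt_one hh]
    exact_mod_cast (by omega : q < h)
  have := ge_of_tendsto' hlim hb'
  norm_num at this

end pair
end HopfDim

namespace HopfDim

open Coalgebra TensorProduct HopfAlgebra

section final

variable {k K H L : Type*} [Field k] [Ring K] [Ring H] [Ring L]
  [HopfAlgebra k K] [HopfAlgebra k H] [HopfAlgebra k L]

lemma nontriv (k A : Type*) [Field k] [Ring A] [HopfAlgebra k A] : Nontrivial A := by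
  refine ⟨1, 0, fun h => ?_⟩
  have h1 : (counit (1 : A) : k) = 1 := Bialgebra.counit_one
  rw [h, map_zero] at h1
  exact zero_ne_one h1

lemma map_antipode' (i : K →ₐc[k] H) (x : K) : antipode k (i x) = i (antipode k x) := by
  let i' : K →ₗ[k] H := (i : K →ₐ[k] H).toLinearMap
  have h1 : WithConv.toConv (antipode k ∘ₗ i') * WithConv.toConv i' = 1 := by
    ext c
    rw [((ℛ k c)).convMul_apply]
    have := sum_antipode_mul_eq_algebraMap_counit ((ℛ k c).induced i)
    simpa [i'] using this
  have h2 : WithConv.toConv i' * WithConv.toConv (i' ∘ₗ antipode k) = 1 := by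
    ext c
    rw [((ℛ k c)).convMul_apply]
    have := congrArg i (sum_mul_antipode_eq_algebraMap_counit (ℛ k c))
    rw [map_sum, Algebra.algebraMap_eq_smul_one, map_smul, map_one,
      ← Algebra.algebraMap_eq_smul_one] at this
    simpa [i'] using this
  have h3 := left_inv_eq_right_inv h1 h2
  have h4 := congrArg WithConv.ofConv h3
  exact LinearMap.congr_fun h4 x

lemma G_hrep [FiniteDimensional k H] [FiniteDimensional k K]
    (i : K →ₐc[k] H) (π : H →ₐc[k] L) (hπ : Function.Surjective π)
    (hker : {h : H | π h = 0} =
      (Submodule.span k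
        {y : H | ∃ (h : H) (x : K), Coalgebra.counit x = (0 : k) ∧ y = h * i x} :
          Submodule k H)) : G (hrep i) = Module.finrank k L := by
  haveI := nontriv k H
  haveI := nontriv k K
  have hS := antipode_bijective (k := k) (A := H)
  have hSK := antipode_bijective (k := k) (A := K)
  let S := LinearEquiv.ofBijective (antipode k : H →ₗ[k] H) hS
  have hS' : ∀ h, S h = antipode k h := fun _ => rfl
  let π' : H →ₗ[k] L := (π : H →ₐ[k] L).toLinearMap
  have hk : LinearMap.ker π' = Submodule.span k
        {y : H | ∃ (h : H) (x : K), Coalgebra.counit x = (0 : k) ∧ y = h * i x} := by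
    apply SetLike.coe_injective
    rw [← hker]
    rfl
  have key : ∀ φ : Module.Dual k H, φ ∈ inv (hrep i) ↔
      S.dualMap φ ∈ (LinearMap.ker π').dualAnnihilator := by
    intro φ
    rw [mem_inv, Submodule.mem_dualAnnihilator, hk]
    constructor
    · intro h w hw
      induction hw using Submodule.span_induction with
      | mem y hy =>
        obtain ⟨h', x, hx, rfl⟩ := hy
        rw [LinearEquiv.dualMap_apply, hS', antipode_mul_antidistrib, map_antipode', ← hrep_apply,
          h, counit_antipode, hx, zero_mul]
      | zero => simp
      | add a b _ _ ha hb => rw [map_add, ha, hb, add_zero]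
      | smul c a _ ha => rw [map_smul, ha, smul_zero]
    · intro h x v
      obtain ⟨x, rfl⟩ := hSK.2 x
      obtain ⟨v, rfl⟩ := hS.2 v
      have h1 := h (v * i (x - algebraMap k K (counit x)))
        (Submodule.subset_span ⟨v, _, by simp, rfl⟩)
      rw [LinearEquiv.dualMap_apply, hS', antipode_mul_antidistrib, map_antipode'] at h1
      rw [hrep_apply, counit_antipode]
      rw [map_sub, Algebra.algebraMap_eq_smul_one, map_smul, antipode_one, map_sub, map_smul,
        map_one, sub_mul, map_sub, smul_mul_assoc, one_mul, map_smul, smul_eq_mul] at h1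
      exact sub_eq_zero.1 h1
  have hmap : (inv (hrep i)).map S.dualMap.toLinearMap = (LinearMap.ker π').dualAnnihilator := by
    ext ψ
    rw [Submodule.mem_map]
    constructor
    · rintro ⟨φ, hφ, rfl⟩
      exact (key φ).1 hφ
    · intro hψ
      refine ⟨S.dualMap.symm ψ, (key _).2 ?_, ?_⟩
      · rw [LinearEquiv.apply_symm_apply]; exact hψ
      · exact LinearEquiv.apply_symm_apply _ _
  have e1 : G (hrep i) = Module.finrank k (LinearMap.ker π').dualAnnihilator := by
    rw [← hmap]
    exact (LinearEquiv.finrank_map_eq S.dualMap (inv (hrep i))).symm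
  have e2 := Subspace.finrank_add_finrank_dualAnnihilator_eq (LinearMap.ker π')
  have e3 := LinearMap.finrank_range_add_finrank_ker π'
  rw [LinearMap.range_eq_top.2 (show Function.Surjective π' from hπ), finrank_top] at e3
  omega

end final
end HopfDim

/-- Let `k → K →ⁱ H →^π L → k` be an exact sequence of
finite-dimensional Hopf algebras over a field `k` of characteristic `0`
(`i` an injective Hopf algebra map, `π` a surjective Hopf algebra map,
`π ∘ i = ε_K · 1`, and `ker π = H · i(K⁺)` where `K⁺ = ker ε_K`).
Then `dim H = dim K · dim L`. -/
theorem dim_of_exact_sequence (k : Type*) [Field k] [CharZero k]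
    (K H L : Type*) [Ring K] [Ring H] [Ring L]
    [HopfAlgebra k K] [HopfAlgebra k H] [HopfAlgebra k L]
    [FiniteDimensional k K] [FiniteDimensional k H] [FiniteDimensional k L]
    (i : K →ₐc[k] H) (π : H →ₐc[k] L)
    (hi : Function.Injective i) (hπ : Function.Surjective π)
    (hcomp : ∀ x : K, π (i x) = algebraMap k L (Coalgebra.counit x))
    (hker : {h : H | π h = 0} =
      (Submodule.span k
        {y : H | ∃ (h : H) (x : K), Coalgebra.counit x = (0 : k) ∧ y = h * i x} :
          Submodule k H)) :
    Module.finrank k H = Module.finrank k K * Module.finrank k L := by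
  haveI := HopfDim.nontriv k K
  rw [← HopfDim.G_hrep i π hπ hker]
  exact (HopfDim.main_dim i hi).symm
end
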